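/- arXiv:2210.02423 — 2 statements merged into one kernel-verified Lean document; each statement's English description precedes it below -/
import Mathlib

section
/- Component expansion of a symmetric spinor in the dyad basis (equation (eq:phiklGHPExpansion) in the binary-form model): for every φ ∈ S_{k,l}, one has φ = Σ_{i=0}^{k} Σ_{j=0}^{l} (−1)^{k−i+l−j} · C(k,i) · C(l,j) · φ_{i,j} · E^{i,j}_{k,l}, where the scalar components are φ_{i,j} := E^{k−i,l−j}_{k,l} ⊙_{k,l} φ. -/
open MvPolynomial Finset

noncomputable section

/-- Iterated partial derivatives `∂x^a ∂y^b ∂u^c ∂v^d` on `ℂ[x,y,u,v]`,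
with variables `x = X 0`, `y = X 1`, `u = X 2`, `v = X 3`. -/
def Dop (a b c d : ℕ) (P : MvPolynomial (Fin 4) ℂ) : MvPolynomial (Fin 4) ℂ :=
  (fun Q => pderiv (0 : Fin 4) Q)^[a] <|
  (fun Q => pderiv (1 : Fin 4) Q)^[b] <|
  (fun Q => pderiv (2 : Fin 4) Q)^[c] <|
  (fun Q => pderiv (3 : Fin 4) Q)^[d] P

/-- `SS k l P`: `P ∈ S_{k,l}`, i.e. `P` is bihomogeneous of degree `k` in `(x,y)`
and degree `l` in `(u,v)`. -/
def SS (k l : ℕ) (P : MvPolynomial (Fin 4) ℂ) : Prop :=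
  MvPolynomial.IsWeightedHomogeneous (![1, 1, 0, 0] : Fin 4 → ℕ) P k ∧
  MvPolynomial.IsWeightedHomogeneous (![0, 0, 1, 1] : Fin 4 → ℕ) P l

/-- The symmetric product `φ ⊙_{m,n} ψ` for `φ ∈ S_{i,j}`, `ψ ∈ S_{k,l}`;
defined to be `0` if `(m,n)` lies outside `0 ≤ m ≤ min(i,k)`, `0 ≤ n ≤ min(j,l)`. -/
def symProd (i j k l : ℕ) (m n : ℤ) (φ ψ : MvPolynomial (Fin 4) ℂ) :
    MvPolynomial (Fin 4) ℂ :=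
  if 0 ≤ m ∧ m ≤ min (i : ℤ) (k : ℤ) ∧ 0 ≤ n ∧ n ≤ min (j : ℤ) (l : ℤ) then
    ((((i - m.toNat).factorial * (k - m.toNat).factorial * (j - n.toNat).factorial *
        (l - n.toNat).factorial : ℕ) : ℂ) /
      (((i.factorial * k.factorial * j.factorial * l.factorial : ℕ)) : ℂ)) •
    ∑ a ∈ Finset.range (m.toNat + 1), ∑ b ∈ Finset.range (n.toNat + 1),
      ((-1 : ℂ) ^ (a + b) * (m.toNat.choose a : ℂ) * (n.toNat.choose b : ℂ)) •
        (Dop a (m.toNat - a) b (n.toNat - b) φ *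
          Dop (m.toNat - a) a (n.toNat - b) b ψ)
  else 0

/-- The symmetric dyad basis element `E^{n,m}_{k,l} = x^n y^(k-n) u^m v^(l-m) ∈ S_{k,l}`. -/
def Eb (k l n m : ℕ) : MvPolynomial (Fin 4) ℂ :=
  X 0 ^ n * X 1 ^ (k - n) * X 2 ^ m * X 3 ^ (l - m)

/-- The scalar component `φ_{i,j} = E^{k-i,l-j}_{k,l} ⊙_{k,l} φ ∈ ℂ` of `φ ∈ S_{k,l}`. -/
def comp (k l : ℕ) (φ : MvPolynomial (Fin 4) ℂ) (i j : ℕ) : ℂ :=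
  MvPolynomial.constantCoeff (symProd k l k l (k : ℤ) (l : ℤ) (Eb k l (k - i) (l - j)) φ)

/-- exponent vector -/
def mon (a b c d : ℕ) : Fin 4 →₀ ℕ :=
  Finsupp.single 0 a + Finsupp.single 1 b + Finsupp.single 2 c + Finsupp.single 3 d

lemma mon_inj {a b c d a' b' c' d' : ℕ} :
    mon a b c d = mon a' b' c' d' ↔ a = a' ∧ b = b' ∧ c = c' ∧ d = d' := by
  constructor
  · intro h
    have h0 := DFunLike.congr_fun h 0
    have h1 := DFunLike.congr_fun h 1
    have h2 := DFunLike.congr_fun h 2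
    have h3 := DFunLike.congr_fun h 3
    simp [mon] at h0 h1 h2 h3
    exact ⟨h0, h1, h2, h3⟩
  · rintro ⟨rfl, rfl, rfl, rfl⟩; rfl

lemma eq_mon (m : Fin 4 →₀ ℕ) : m = mon (m 0) (m 1) (m 2) (m 3) := by
  ext i
  fin_cases i <;> simp [mon]

lemma Eb_eq (k l n m : ℕ) : Eb k l n m = monomial (mon n (k - n) m (l - m)) 1 := by
  simp [Eb, mon, X_pow_eq_monomial, monomial_mul]

lemma coeff_pd (i : Fin 4) (P : MvPolynomial (Fin 4) ℂ) (m : Fin 4 →₀ ℕ) :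
    coeff m (pderiv i P) = coeff (m + Finsupp.single i 1) P * ((m i + 1 : ℕ) : ℂ) := by
  induction P using MvPolynomial.induction_on' with
  | monomial u a =>
    rw [pderiv_monomial, coeff_monomial, coeff_monomial]
    by_cases h : u = m + Finsupp.single i 1
    · subst h; simp
    · rw [if_neg h, zero_mul]
      split_ifs with h'
      · have : u i = 0 := by
          by_contra hu
          apply h
          rw [← h']
          ext j
          by_cases hj : i = j
          · subst hj; simp; omega
          · simp [hj]
        simp [this]
      · rfl
  | add p q hp hq => simp [hp, hq, add_mul]

lemma coeff_iter (i : Fin 4) (n : ℕ) (P : MvPolynomial (Fin 4) ℂ) (m : Fin 4 →₀ ℕ) :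
    coeff m ((fun Q => pderiv i Q)^[n] P) * ((m i).factorial : ℂ)
      = coeff (m + Finsupp.single i n) P * ((m i + n).factorial : ℂ) := by
  induction n generalizing P with
  | zero => simp
  | succ n ih =>
    rw [Function.iterate_succ_apply, ih, coeff_pd, add_assoc, ← Finsupp.single_add,
      ← add_assoc, Nat.factorial_succ]
    simp
    ring

lemma coeff_iter' (i : Fin 4) (n : ℕ) (P : MvPolynomial (Fin 4) ℂ) (m : Fin 4 →₀ ℕ)
    (h : m i = 0) :
    coeff m ((fun Q => pderiv i Q)^[n] P)
      = coeff (m + Finsupp.single i n) P * (n.factorial : ℂ) := by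
  simpa [h] using coeff_iter i n P m

lemma cc_Dop (a b c d : ℕ) (P : MvPolynomial (Fin 4) ℂ) :
    constantCoeff (Dop a b c d P) = coeff (mon a b c d) P *
      ((a.factorial : ℂ) * b.factorial * c.factorial * d.factorial) := by
  rw [constantCoeff_eq, Dop, coeff_iter' _ _ _ _ (by simp), coeff_iter' _ _ _ _ (by simp),
    coeff_iter' _ _ _ _ (by simp), coeff_iter' _ _ _ _ (by simp), mon, zero_add]
  ring

lemma comp_eq (k l : ℕ) (φ : MvPolynomial (Fin 4) ℂ) (i j : ℕ) (hi : i ≤ k) (hj : j ≤ l) :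
    (-1 : ℂ) ^ (k - i + l - j) * (k.choose i : ℂ) * (l.choose j : ℂ) * comp k l φ i j
      = coeff (mon i (k - i) j (l - j)) φ := by
  have key : comp k l φ i j = 1 / ((k.factorial : ℂ) * k.factorial * l.factorial * l.factorial) *
      ((-1 : ℂ) ^ (k - i + (l - j)) * (k.choose i : ℂ) * (l.choose j : ℂ) *
      (((k-i).factorial : ℂ) * i.factorial * (l-j).factorial * j.factorial) *
      (coeff (mon i (k - i) j (l - j)) φ *
       ((i.factorial : ℂ) * (k-i).factorial * j.factorial * (l-j).factorial))) := by
    rw [comp, symProd, if_pos (by simp)]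
    simp only [Int.toNat_natCast, constantCoeff_smul, map_sum, map_mul, cc_Dop, Eb_eq,
      coeff_monomial, mon_inj, smul_eq_mul]
    congr 1
    · simp
    rw [Finset.sum_eq_single (k - i), Finset.sum_eq_single (l - j)]
    · simp only [Nat.sub_sub_self hi, Nat.sub_sub_self hj, Nat.choose_symm hi, Nat.choose_symm hj]
      simp
      ring
    · intro b hb hne
      simp [Ne.symm hne]
    · intro h; exact absurd (Finset.mem_range.2 (by omega)) h
    · intro b hb hne
      apply Finset.sum_eq_zero
      intro c hc
      simp [Ne.symm hne]
    · intro h; exact absurd (Finset.mem_range.2 (by omega)) h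
  have e : k - i + l - j = k - i + (l - j) := by omega
  have hk : (k.choose i : ℂ) * i.factorial * (k-i).factorial = k.factorial := by
    exact_mod_cast Nat.choose_mul_factorial_mul_factorial hi
  have hl : (l.choose j : ℂ) * j.factorial * (l-j).factorial = l.factorial := by
    exact_mod_cast Nat.choose_mul_factorial_mul_factorial hj
  have hs : (-1 : ℂ) ^ (k - i + (l - j)) * (-1 : ℂ) ^ (k - i + (l - j)) = 1 := by
    rw [← mul_pow]; simp
  have k0 : (k.factorial : ℂ) ≠ 0 := by exact_mod_cast k.factorial_ne_zero
  have l0 : (l.factorial : ℂ) ≠ 0 := by exact_mod_cast l.factorial_ne_zero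
  rw [key, e]
  generalize (-1 : ℂ) ^ (k - i + (l - j)) = s at *
  calc _ = (s * s) * (1 / ((k.factorial : ℂ) * k.factorial * l.factorial * l.factorial)) *
        ((k.choose i : ℂ) * i.factorial * (k-i).factorial) ^ 2 *
        ((l.choose j : ℂ) * j.factorial * (l-j).factorial) ^ 2 *
        coeff (mon i (k - i) j (l - j)) φ := by ring
    _ = _ := by
      rw [hs, hk, hl]
      field_simp

/-- Component expansion of a symmetric spinor in the dyad basis
(equation (eq:phiklGHPExpansion)). -/
theorem stmt9 (k l : ℕ) (φ : MvPolynomial (Fin 4) ℂ) (hφ : SS k l φ) :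
    φ = ∑ i ∈ Finset.range (k + 1), ∑ j ∈ Finset.range (l + 1),
        ((-1 : ℂ) ^ (k - i + l - j) * (k.choose i : ℂ) * (l.choose j : ℂ) *
          comp k l φ i j) • Eb k l i j := by
  have h1 : ∀ i ∈ Finset.range (k + 1), ∀ j ∈ Finset.range (l + 1),
      ((-1 : ℂ) ^ (k - i + l - j) * (k.choose i : ℂ) * (l.choose j : ℂ) *
          comp k l φ i j) • Eb k l i j =
        monomial (mon i (k - i) j (l - j)) (coeff (mon i (k - i) j (l - j)) φ) := by
    intro i hi j hj
    rw [comp_eq k l φ i j (by simpa [Nat.lt_succ_iff] using hi)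
      (by simpa [Nat.lt_succ_iff] using hj), Eb_eq, smul_monomial]
    simp
  rw [Finset.sum_congr rfl (fun i hi => Finset.sum_congr rfl (h1 i hi))]
  ext m
  simp only [coeff_sum, coeff_monomial]
  by_cases hm : coeff m φ = 0
  · rw [hm]
    symm
    apply Finset.sum_eq_zero
    intro i _
    apply Finset.sum_eq_zero
    intro j _
    split_ifs with h
    · rw [h, hm]
    · rfl
  · have w1 := hφ.1 hm
    have w2 := hφ.2 hm
    simp [Finsupp.weight_apply, Finsupp.sum_fintype, Fin.sum_univ_four] at w1 w2
    have e1 : k - m 0 = m 1 := by omega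
    have e2 : l - m 2 = m 3 := by omega
    rw [Finset.sum_eq_single (m 0), Finset.sum_eq_single (m 2)]
    · rw [e1, e2, ← eq_mon, if_pos rfl]
    · intro j _ hne
      rw [if_neg]
      rw [eq_mon m, mon_inj]
      rintro ⟨_, _, h, _⟩
      exact hne h
    · intro h; exact absurd (Finset.mem_range.2 (by omega)) h
    · intro i _ hne
      apply Finset.sum_eq_zero
      intro j _
      rw [if_neg]
      rw [eq_mon m, mon_inj]
      rintro ⟨h, _⟩
      exact hne h
    · intro h; exact absurd (Finset.mem_range.2 (by omega)) h
end
end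

section
/- Components of the symmetric product (Lemma 9): for all φ ∈ S_{i,j}, ψ ∈ S_{k,l}, all integers m,n with 0 ≤ m ≤ min(i,k), 0 ≤ n ≤ min(j,l), and all integers s,t with 0 ≤ s ≤ i+k−2m, 0 ≤ t ≤ j+l−2n, the components of the symmetric product satisfy (φ ⊙_{m,n} ψ)_{s,t} = Σ_{p=0}^{k} Σ_{q=0}^{l} G_{i,k}^{m,p,s} · G_{j,l}^{n,q,t} · φ_{s+m−p, t+n−q} · ψ_{p,q}, where G_{i,k}^{m,p,s} := Σ_{r=0}^{m} (−1)^r · C(i, s+m−p) · C(i+p−s−m, r) · C(s+m−p, m−r) · C(k,p) · C(k−p, m−r) · C(p,r) / ( C(i,m) · C(k,m) · C(m,r) · C(i+k−2m, s) ), and components φ_{a,b} with (a,b) outside the range 0 ≤ a ≤ i, 0 ≤ b ≤ j are taken to be 0. -/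
open MvPolynomial Finset

noncomputable section

/-- Binomial coefficient on integers with the convention `C(a,b) = 0` if `b < 0` or `b > a`. -/
def Cz (a b : ℤ) : ℚ := if 0 ≤ b ∧ b ≤ a then (a.toNat.choose b.toNat : ℚ) else 0

/-- The `(p,q)`-summand of the associativity coefficient `F_{i,r,k}^{t,m,M}`. -/
def Fsummand (i r k t m M p q : ℕ) : ℚ :=
  (-1 : ℚ) ^ ((t : ℤ) - p + q) *
      Cz ((k : ℤ) - m) p * Cz (m : ℤ) ((M : ℤ) - p - q) * Cz ((k : ℤ) - m - p) q *
      Cz ((r : ℤ) - m) ((t : ℤ) - p) * Cz ((i : ℤ) - t) ((M : ℤ) - p - q) *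
      Cz ((t : ℤ) - p) q /
    (Cz ((i : ℤ) + k - M - p + 1) ((M : ℤ) - p) * Cz ((M : ℤ) - p) q *
      Cz ((k : ℤ) - 2 * m + r) t)

/-- The associativity coefficient `F_{i,r,k}^{t,m,M}`. -/
def Fcoef (i r k t m M : ℕ) : ℚ :=
  ∑ p ∈ Finset.range (M + 1), ∑ q ∈ Finset.range (M - p + 1), Fsummand i r k t m M p q

/-- The scalar component `φ_{a,b}` of `φ ∈ S_{k,l}` with integer indices,
taken to be `0` outside the range `0 ≤ a ≤ k`, `0 ≤ b ≤ l`. -/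
def compZ (k l : ℕ) (φ : MvPolynomial (Fin 4) ℂ) (a b : ℤ) : ℂ :=
  if 0 ≤ a ∧ a ≤ (k : ℤ) ∧ 0 ≤ b ∧ b ≤ (l : ℤ) then
    MvPolynomial.constantCoeff
      (symProd k l k l (k : ℤ) (l : ℤ) (Eb k l (k - a.toNat) (l - b.toNat)) φ)
  else 0

/-- The coefficient `G_{i,k}^{m,p,s}` of Lemma 9. -/
def Gcoef (i k m p s : ℕ) : ℚ :=
  ∑ r ∈ Finset.range (m + 1),
    (-1 : ℚ) ^ r * Cz (i : ℤ) ((s : ℤ) + m - p) * Cz ((i : ℤ) + p - s - m) (r : ℤ) *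
        Cz ((s : ℤ) + m - p) ((m : ℤ) - r) * Cz (k : ℤ) (p : ℤ) *
        Cz ((k : ℤ) - p) ((m : ℤ) - r) * Cz (p : ℤ) (r : ℤ) /
      (Cz (i : ℤ) (m : ℤ) * Cz (k : ℤ) (m : ℤ) * Cz (m : ℤ) (r : ℤ) *
        Cz ((i : ℤ) + k - 2 * m) (s : ℤ))

/-! ### Helper lemmas -/

theorem Dop_add (a b c d : ℕ) (P Q : MvPolynomial (Fin 4) ℂ) :
    Dop a b c d (P + Q) = Dop a b c d P + Dop a b c d Q := by
  have h : ∀ (v : Fin 4) (n : ℕ) (P Q : MvPolynomial (Fin 4) ℂ),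
      (fun Q => pderiv v Q)^[n] (P + Q) =
        (fun Q => pderiv v Q)^[n] P + (fun Q => pderiv v Q)^[n] Q := by
    intro v n
    induction n with
    | zero => intro P Q; rfl
    | succ n ih => intro P Q; simp only [Function.iterate_succ_apply, map_add, ih]
  simp only [Dop, h]

theorem iter_smul (v : Fin 4) (n : ℕ) (z : ℂ) : ∀ (P : MvPolynomial (Fin 4) ℂ),
      (fun Q => pderiv v Q)^[n] (z • P) = z • (fun Q => pderiv v Q)^[n] P := by
  induction n with
  | zero => intro P; rfl
  | succ n ih => intro P; simp only [Function.iterate_succ_apply, Derivation.map_smul, ih]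

theorem Dop_smul (a b c d : ℕ) (z : ℂ) (P : MvPolynomial (Fin 4) ℂ) :
    Dop a b c d (z • P) = z • Dop a b c d P := by
  simp only [Dop, iter_smul]

theorem symProd_add_left (i j k l : ℕ) (m n : ℤ) (P Q R : MvPolynomial (Fin 4) ℂ) :
    symProd i j k l m n (P + Q) R = symProd i j k l m n P R + symProd i j k l m n Q R := by
  unfold symProd
  split_ifs
  · simp only [Dop_add, add_mul, smul_add, Finset.sum_add_distrib]
  · simp

theorem symProd_add_right (i j k l : ℕ) (m n : ℤ) (P Q R : MvPolynomial (Fin 4) ℂ) :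
    symProd i j k l m n R (P + Q) = symProd i j k l m n R P + symProd i j k l m n R Q := by
  unfold symProd
  split_ifs
  · simp only [Dop_add, mul_add, smul_add, Finset.sum_add_distrib]
  · simp

theorem symProd_smul_left (i j k l : ℕ) (m n : ℤ) (z : ℂ) (P R : MvPolynomial (Fin 4) ℂ) :
    symProd i j k l m n (z • P) R = z • symProd i j k l m n P R := by
  unfold symProd
  split_ifs
  · simp only [Dop_smul, smul_mul_assoc, Finset.smul_sum]
    refine Finset.sum_congr rfl fun a _ => Finset.sum_congr rfl fun b _ => ?_
    simp only [smul_smul]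
    congr 1
    ring
  · simp

theorem symProd_smul_right (i j k l : ℕ) (m n : ℤ) (z : ℂ) (P R : MvPolynomial (Fin 4) ℂ) :
    symProd i j k l m n R (z • P) = z • symProd i j k l m n R P := by
  unfold symProd
  split_ifs
  · simp only [Dop_smul, mul_smul_comm, Finset.smul_sum]
    refine Finset.sum_congr rfl fun a _ => Finset.sum_congr rfl fun b _ => ?_
    simp only [smul_smul]
    congr 1
    ring
  · simp

theorem compZ_add (k l : ℕ) (P Q : MvPolynomial (Fin 4) ℂ) (a b : ℤ) :
    compZ k l (P + Q) a b = compZ k l P a b + compZ k l Q a b := by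
  unfold compZ
  split_ifs
  · simp only [symProd_add_right, map_add]
  · simp

theorem compZ_smul (k l : ℕ) (z : ℂ) (P : MvPolynomial (Fin 4) ℂ) (a b : ℤ) :
    compZ k l (z • P) a b = z * compZ k l P a b := by
  unfold compZ
  split_ifs
  · rw [symProd_smul_right, smul_eq_C_mul, map_mul, constantCoeff_C]
  · simp

theorem SS_induction {k l : ℕ} (p : MvPolynomial (Fin 4) ℂ → Prop)
    (hadd : ∀ P Q, p P → p Q → p (P + Q)) (hsmul : ∀ (z : ℂ) P, p P → p (z • P))
    (hE : ∀ A B, A ≤ k → B ≤ l → p (Eb k l A B))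
    (φ : MvPolynomial (Fin 4) ℂ) (hφ : SS k l φ) : p φ := by
  have h0 : p 0 := by
    have := hsmul 0 _ (hE 0 0 (Nat.zero_le _) (Nat.zero_le _))
    simpa using this
  rw [φ.as_sum]
  refine Finset.sum_induction _ p hadd h0 ?_
  intro d hd
  have hc := mem_support_iff.mp hd
  have h1 := hφ.1 hc
  have h2 := hφ.2 hc
  simp [Finsupp.weight_apply, Finsupp.sum_fintype, Fin.sum_univ_four] at h1 h2
  have : monomial d (coeff d φ) = coeff d φ • Eb k l (d 0) (d 2) := by
    rw [monomial_eq, smul_eq_C_mul, Finsupp.prod_fintype _ _ (by simp)]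
    simp only [Fin.prod_univ_four, Eb]
    rw [← h1, ← h2]
    simp
  rw [this]
  exact hsmul _ _ (hE _ _ (by omega) (by omega))

/-- general monomial -/
def Mo (A B C D : ℕ) : MvPolynomial (Fin 4) ℂ := X 0 ^ A * X 1 ^ B * X 2 ^ C * X 3 ^ D

theorem iter0 (a A B C D : ℕ) : (fun Q => pderiv (0 : Fin 4) Q)^[a] (Mo A B C D) =
    (A.descFactorial a : ℂ) • Mo (A - a) B C D := by
  induction a with
  | zero => simp
  | succ n ih =>
    rw [Function.iterate_succ_apply', ih, Nat.descFactorial_succ]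
    simp [Mo, Derivation.leibniz, Derivation.leibniz_pow, pderiv_X, Pi.single_apply,
      smul_eq_C_mul, Nat.sub_sub]
    ring

theorem iter1 (a A B C D : ℕ) : (fun Q => pderiv (1 : Fin 4) Q)^[a] (Mo A B C D) =
    (B.descFactorial a : ℂ) • Mo A (B - a) C D := by
  induction a with
  | zero => simp
  | succ n ih =>
    rw [Function.iterate_succ_apply', ih, Nat.descFactorial_succ]
    simp [Mo, Derivation.leibniz, Derivation.leibniz_pow, pderiv_X, Pi.single_apply,
      smul_eq_C_mul, Nat.sub_sub]
    ring

theorem iter2 (a A B C D : ℕ) : (fun Q => pderiv (2 : Fin 4) Q)^[a] (Mo A B C D) =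
    (C.descFactorial a : ℂ) • Mo A B (C - a) D := by
  induction a with
  | zero => simp
  | succ n ih =>
    rw [Function.iterate_succ_apply', ih, Nat.descFactorial_succ]
    simp [Mo, Derivation.leibniz, Derivation.leibniz_pow, pderiv_X, Pi.single_apply,
      smul_eq_C_mul, Nat.sub_sub]
    ring

theorem iter3 (a A B C D : ℕ) : (fun Q => pderiv (3 : Fin 4) Q)^[a] (Mo A B C D) =
    (D.descFactorial a : ℂ) • Mo A B C (D - a) := by
  induction a with
  | zero => simp
  | succ n ih =>
    rw [Function.iterate_succ_apply', ih, Nat.descFactorial_succ]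
    simp [Mo, Derivation.leibniz, Derivation.leibniz_pow, pderiv_X, Pi.single_apply,
      smul_eq_C_mul, Nat.sub_sub]
    ring

theorem Dop_Mo (a b c d A B C D : ℕ) : Dop a b c d (Mo A B C D) =
    ((A.descFactorial a : ℂ) * B.descFactorial b * (C.descFactorial c * D.descFactorial d)) •
      Mo (A - a) (B - b) (C - c) (D - d) := by
  simp only [Dop, iter3, iter_smul, iter2, iter1, iter0, smul_smul]
  congr 1
  ring

theorem Mo_mul (A B C D A' B' C' D' : ℕ) :
    Mo A B C D * Mo A' B' C' D' = Mo (A + A') (B + B') (C + C') (D + D') := by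
  simp only [Mo]; ring

/-- term of the one-dimensional coefficient -/
def ht (i k m A P a : ℕ) : ℂ :=
  (-1) ^ a * (m.choose a : ℂ) * ((A.descFactorial a : ℂ) * ((i - A).descFactorial (m - a) : ℂ)) *
    ((P.descFactorial (m - a) : ℂ) * ((k - P).descFactorial a : ℂ))

theorem ht_ne (i k m A P a : ℕ) (h : ht i k m A P a ≠ 0) :
    a ≤ A ∧ m - a ≤ i - A ∧ m - a ≤ P ∧ a ≤ k - P := by
  simp only [ht, ne_eq, mul_eq_zero, not_or, Nat.cast_eq_zero, Nat.descFactorial_eq_zero_iff_lt,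
    not_lt] at h
  tauto

/-- the one-dimensional coefficient -/
def Hc (i k m A P : ℕ) : ℂ :=
  (((i - m).factorial * (k - m).factorial : ℕ) : ℂ) / ((i.factorial * k.factorial : ℕ) : ℂ) *
    ∑ a ∈ Finset.range (m + 1), ht i k m A P a

theorem Hc_ne {i k m A P : ℕ} (hA : A ≤ i) (hP : P ≤ k) (h : Hc i k m A P ≠ 0) :
    m ≤ A + P ∧ A + P + m ≤ i + k := by
  obtain ⟨a, ha, h⟩ := Finset.exists_ne_zero_of_sum_ne_zero (right_ne_zero_of_mul h)
  have := ht_ne _ _ _ _ _ _ h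
  simp at ha
  omega

theorem symProd_Eb (i j k l m n A B P Q : ℕ) (hm : m ≤ min i k) (hn : n ≤ min j l)
    (hA : A ≤ i) (hB : B ≤ j) (hP : P ≤ k) (hQ : Q ≤ l) :
    symProd i j k l m n (Eb i j A B) (Eb k l P Q) =
      (Hc i k m A P * Hc j l n B Q) •
        Eb (i + k - 2 * m) (j + l - 2 * n) (A + P - m) (B + Q - n) := by
  unfold symProd
  rw [if_pos (by omega)]
  have hE : ∀ k l A B, Eb k l A B = Mo A (k - A) B (l - B) := fun _ _ _ _ => rfl
  simp only [hE, Dop_Mo, Int.toNat_natCast, smul_mul_smul_comm, Mo_mul, smul_smul]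
  have key : ∀ a ∈ Finset.range (m + 1), ∀ b ∈ Finset.range (n + 1),
      ((-1 : ℂ) ^ (a + b) * (m.choose a : ℂ) * (n.choose b : ℂ) *
        (((A.descFactorial a : ℂ) * ((i - A).descFactorial (m - a) : ℂ) *
          ((B.descFactorial b : ℂ) * ((j - B).descFactorial (n - b) : ℂ))) *
         ((P.descFactorial (m - a) : ℂ) * ((k - P).descFactorial a : ℂ) *
          ((Q.descFactorial (n - b) : ℂ) * ((l - Q).descFactorial b : ℂ))))) •
        Mo (A - a + (P - (m - a))) (i - A - (m - a) + (k - P - a))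
          (B - b + (Q - (n - b))) (j - B - (n - b) + (l - Q - b)) =
      (ht i k m A P a * ht j l n B Q b) •
        Mo (A + P - m) (i + k - 2 * m - (A + P - m)) (B + Q - n)
          (j + l - 2 * n - (B + Q - n)) := by
    intro a ha b hb
    simp at ha hb
    have e : ((-1 : ℂ) ^ (a + b) * (m.choose a : ℂ) * (n.choose b : ℂ) *
        (((A.descFactorial a : ℂ) * ((i - A).descFactorial (m - a) : ℂ) *
          ((B.descFactorial b : ℂ) * ((j - B).descFactorial (n - b) : ℂ))) *
         ((P.descFactorial (m - a) : ℂ) * ((k - P).descFactorial a : ℂ) *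
          ((Q.descFactorial (n - b) : ℂ) * ((l - Q).descFactorial b : ℂ))))) =
        ht i k m A P a * ht j l n B Q b := by
      simp only [ht]; ring
    rw [e]
    by_cases h1 : ht i k m A P a = 0
    · simp [h1]
    by_cases h2 : ht j l n B Q b = 0
    · simp [h2]
    have := ht_ne _ _ _ _ _ _ h1
    have := ht_ne _ _ _ _ _ _ h2
    congr 2 <;> omega
  rw [Finset.sum_congr rfl fun a ha => Finset.sum_congr rfl (key a ha)]
  simp only [← Finset.sum_smul, ← Finset.mul_sum, ← Finset.sum_mul, smul_smul]
  congr 1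
  simp only [Hc]
  push_cast
  ring

/-- one-dimensional component of a basis element -/
def hz (k : ℕ) (a : ℤ) (A : ℕ) : ℂ := if a = A then (-1) ^ (k - A) / (k.choose A : ℂ) else 0

theorem Hc_full (k a A : ℕ) (ha : a ≤ k) (hA : A ≤ k) : Hc k k k (k - a) A = hz k a A := by
  unfold Hc hz
  rw [Finset.sum_eq_single (k - a)]
  · by_cases h : a = A
    · subst h
      rw [if_pos rfl]
      have e : k - (k - a) = a := by omega
      have f1 := Nat.choose_mul_factorial_mul_factorial ha
      have f0 : ((k.choose a : ℂ)) ≠ 0 := by exact_mod_cast (Nat.choose_pos ha).ne'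
      have f2 : ((k.factorial : ℂ)) ≠ 0 := by exact_mod_cast k.factorial_ne_zero
      have f3 : ((k.choose a : ℂ)) * a.factorial * (k - a).factorial = k.factorial := by
        exact_mod_cast f1
      simp only [ht, e, Nat.choose_symm ha, Nat.descFactorial_self, Nat.sub_self,
        Nat.factorial_zero]
      push_cast
      rw [eq_div_iff f0, ← f3]
      have f4 : ((a.factorial : ℂ)) ≠ 0 := by exact_mod_cast a.factorial_ne_zero
      have f5 : (((k - a).factorial : ℂ)) ≠ 0 := by exact_mod_cast (k - a).factorial_ne_zero
      field_simp
    · rw [if_neg (by exact_mod_cast h)]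
      rw [mul_eq_zero]; right
      by_contra h'
      have := ht_ne _ _ _ _ _ _ h'
      omega
  · intro b hb hne
    simp at hb
    by_contra h'
    have := ht_ne _ _ _ _ _ _ h'
    omega
  · intro h
    exact absurd (Finset.mem_range.mpr (by omega)) h

theorem compZ_Eb (k l A B : ℕ) (a b : ℤ) (hA : A ≤ k) (hB : B ≤ l) :
    compZ k l (Eb k l A B) a b = hz k a A * hz l b B := by
  unfold compZ
  split_ifs with h
  · obtain ⟨h1, h2, h3, h4⟩ := h
    lift a to ℕ using h1
    lift b to ℕ using h3
    simp only [Int.toNat_natCast]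
    rw [symProd_Eb _ _ _ _ _ _ _ _ _ _ (by simp) (by simp) (by omega) (by omega) hA hB,
      Hc_full _ _ _ (by omega) hA, Hc_full _ _ _ (by omega) hB]
    by_cases e1 : a = A
    · by_cases e2 : b = B
      · subst e1 e2
        have z1 : k - a + a - k = 0 := by omega
        have z2 : l - b + b - l = 0 := by omega
        have z3 : k + k - 2 * k = 0 := by omega
        have z4 : l + l - 2 * l = 0 := by omega
        rw [z1, z2, z3, z4]
        simp [Eb, smul_eq_C_mul]
      · simp [hz, e2]
    · simp [hz, e1]
  · by_cases e1 : a = A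
    · have e2 : b ≠ B := by omega
      simp [hz, e2]
    · simp [hz, e1]

theorem Cz_nat (a b : ℕ) : Cz a b = (a.choose b : ℚ) := by
  unfold Cz
  split_ifs with h
  · simp
  · rw [Nat.choose_eq_zero_of_lt (by omega)]; simp

theorem oneD (i k m A P s : ℕ) (hm : m ≤ min i k) (hA : A ≤ i) (hP : P ≤ k)
    (hs : s ≤ i + k - 2 * m) :
    Hc i k m A P * hz (i + k - 2 * m) s (A + P - m) =
      (Gcoef i k m P s : ℂ) * hz i ((s : ℤ) + m - P) A * hz k P P := by
  by_cases h : A + P = s + m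
  · have e1 : ((s : ℤ) + m - P) = A := by omega
    have e2 : (i : ℤ) + P - s - m = ((i - A : ℕ) : ℤ) := by omega
    have e3 : A + P - m = s := by omega
    have e4 : (k : ℤ) - P = ((k - P : ℕ) : ℤ) := by omega
    have e5 : (i : ℤ) + k - 2 * m = ((i + k - 2 * m : ℕ) : ℤ) := by omega
    simp only [hz, e1, e3, if_true, Hc, Gcoef, e2, e4, e5]
    rw [← Finset.sum_range_reflect (fun a => ht i k m A P a)]
    push_cast
    simp only [Finset.mul_sum, Finset.sum_mul]
    refine Finset.sum_congr rfl fun r hr => ?_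
    simp only [Finset.mem_range] at hr
    have e6 : (m : ℤ) - r = ((m - r : ℕ) : ℤ) := by omega
    have e7 : m + 1 - 1 - r = m - r := by omega
    have e8 : m - (m - r) = r := by omega
    simp only [e6, e7, e8, Cz_nat, ht, Nat.descFactorial_eq_factorial_mul_choose]
    have hr' : r ≤ m := by omega
    have ci := Nat.choose_mul_factorial_mul_factorial (show m ≤ i by omega)
    have ck := Nat.choose_mul_factorial_mul_factorial (show m ≤ k by omega)
    have cm := Nat.choose_mul_factorial_mul_factorial hr'
    have ci' : ((i.choose m : ℂ)) * m.factorial * (i - m).factorial = i.factorial := by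
      exact_mod_cast ci
    have ck' : ((k.choose m : ℂ)) * m.factorial * (k - m).factorial = k.factorial := by
      exact_mod_cast ck
    have cm' : ((m.choose r : ℂ)) * r.factorial * (m - r).factorial = m.factorial := by
      exact_mod_cast cm
    have n1 : ((i.choose m : ℂ)) ≠ 0 := by exact_mod_cast (Nat.choose_pos (by omega)).ne'
    have n2 : ((k.choose m : ℂ)) ≠ 0 := by exact_mod_cast (Nat.choose_pos (by omega)).ne'
    have n3 : ((m.choose r : ℂ)) ≠ 0 := by exact_mod_cast (Nat.choose_pos (by omega)).ne'
    have n4 : ((i.choose A : ℂ)) ≠ 0 := by exact_mod_cast (Nat.choose_pos (by omega)).ne'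
    have n5 : ((k.choose P : ℂ)) ≠ 0 := by exact_mod_cast (Nat.choose_pos (by omega)).ne'
    have n6 : (((i + k - 2 * m).choose s : ℂ)) ≠ 0 := by
      exact_mod_cast (Nat.choose_pos (by omega)).ne'
    have n7 : ((r.factorial : ℂ)) ≠ 0 := by exact_mod_cast r.factorial_ne_zero
    have n8 : (((m - r).factorial : ℂ)) ≠ 0 := by exact_mod_cast (m - r).factorial_ne_zero
    have n9 : (((i - m).factorial : ℂ)) ≠ 0 := by exact_mod_cast (i - m).factorial_ne_zero
    have n10 : (((k - m).factorial : ℂ)) ≠ 0 := by exact_mod_cast (k - m).factorial_ne_zero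
    have sg : (-1 : ℂ) ^ (m - r) * (-1) ^ (i + k - 2 * m - s) =
        (-1) ^ r * (-1) ^ (i - A) * (-1) ^ (k - P) := by
      obtain ⟨x, rfl⟩ := Nat.exists_eq_add_of_le hr'
      have z1 : r + x - r = x := by omega
      have z2 : i + k - 2 * (r + x) - s + (r + x) = (i - A) + (k - P) := by omega
      have z3 : (-1 : ℂ) ^ r * (-1) ^ r = 1 := by rw [← mul_pow]; simp
      have z4 : (-1 : ℂ) ^ x * (-1) ^ x = 1 := by rw [← mul_pow]; simp
      rw [z1, mul_assoc ((-1 : ℂ) ^ r), ← pow_add (-1 : ℂ) (i - A), ← z2, pow_add, pow_add]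
      linear_combination -((-1 : ℂ) ^ x * (-1) ^ (i + k - 2 * (r + x) - s)) * z3
    rw [Nat.choose_symm hr']
    push_cast
    rw [← ci', ← ck', ← cm']
    generalize (-1 : ℂ) ^ (m - r) = s1 at *
    generalize (-1 : ℂ) ^ (i + k - 2 * m - s) = s2 at *
    generalize (-1 : ℂ) ^ (i - A) = s3 at *
    generalize (-1 : ℂ) ^ (k - P) = s4 at *
    generalize (-1 : ℂ) ^ r = s5 at *
    field_simp
    linear_combination (((i - A).choose r : ℂ) * (A.choose (m - r)) * ((k - P).choose (m - r)) *
      (P.choose r)) * sg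
  · have e : ((s : ℤ) + m - P) ≠ A := by omega
    have r0 : hz i ((s : ℤ) + m - P) A = 0 := by simp [hz, e]
    rw [r0]
    by_cases h0 : Hc i k m A P = 0
    · simp [h0]
    have := Hc_ne hA hP h0
    have e' : ((s : ℤ)) ≠ ((A + P - m : ℕ) : ℤ) := by omega
    have r1 : hz (i + k - 2 * m) s (A + P - m) = 0 := by unfold hz; rw [if_neg e']
    rw [r1]; simp

/-- Lemma 9: components of the symmetric product. -/
theorem stmt10 (i j k l m n s t : ℕ) (φ ψ : MvPolynomial (Fin 4) ℂ)
    (hφ : SS i j φ) (hψ : SS k l ψ)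
    (hm : m ≤ min i k) (hn : n ≤ min j l)
    (hs : s ≤ i + k - 2 * m) (ht : t ≤ j + l - 2 * n) :
    compZ (i + k - 2 * m) (j + l - 2 * n) (symProd i j k l (m : ℤ) (n : ℤ) φ ψ)
        (s : ℤ) (t : ℤ) =
      ∑ p ∈ Finset.range (k + 1), ∑ q ∈ Finset.range (l + 1),
        ((Gcoef i k m p s * Gcoef j l n q t : ℚ) : ℂ) *
          compZ i j φ ((s : ℤ) + m - p) ((t : ℤ) + n - q) * compZ k l ψ (p : ℤ) (q : ℤ) := by
  revert hφ
  refine SS_induction (k := i) (l := j) (fun φ =>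
    compZ (i + k - 2 * m) (j + l - 2 * n) (symProd i j k l (m : ℤ) (n : ℤ) φ ψ)
        (s : ℤ) (t : ℤ) =
      ∑ p ∈ Finset.range (k + 1), ∑ q ∈ Finset.range (l + 1),
        ((Gcoef i k m p s * Gcoef j l n q t : ℚ) : ℂ) *
          compZ i j φ ((s : ℤ) + m - p) ((t : ℤ) + n - q) * compZ k l ψ (p : ℤ) (q : ℤ)) ?_ ?_ ?_ φ
  · intro P Q h1 h2
    simp only [symProd_add_left, compZ_add, h1, h2, ← Finset.sum_add_distrib]
    refine Finset.sum_congr rfl fun p _ => Finset.sum_congr rfl fun q _ => ?_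
    ring
  · intro z P h1
    simp only [symProd_smul_left, compZ_smul, h1, Finset.mul_sum]
    refine Finset.sum_congr rfl fun p _ => Finset.sum_congr rfl fun q _ => ?_
    ring
  intro A B hA hB
  revert hψ
  refine SS_induction (k := k) (l := l) (fun ψ =>
    compZ (i + k - 2 * m) (j + l - 2 * n) (symProd i j k l (m : ℤ) (n : ℤ) (Eb i j A B) ψ)
        (s : ℤ) (t : ℤ) =
      ∑ p ∈ Finset.range (k + 1), ∑ q ∈ Finset.range (l + 1),
        ((Gcoef i k m p s * Gcoef j l n q t : ℚ) : ℂ) *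
          compZ i j (Eb i j A B) ((s : ℤ) + m - p) ((t : ℤ) + n - q) * compZ k l ψ (p : ℤ) (q : ℤ)) ?_ ?_ ?_ ψ
  · intro P Q h1 h2
    simp only [symProd_add_right, compZ_add, h1, h2, ← Finset.sum_add_distrib]
    refine Finset.sum_congr rfl fun p _ => Finset.sum_congr rfl fun q _ => ?_
    ring
  · intro z P h1
    simp only [symProd_smul_right, compZ_smul, h1, Finset.mul_sum]
    refine Finset.sum_congr rfl fun p _ => Finset.sum_congr rfl fun q _ => ?_
    ring
  intro P Q hP hQ
  rw [symProd_Eb _ _ _ _ _ _ _ _ _ _ hm hn hA hB hP hQ, compZ_smul]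
  have hL : Hc i k m A P * Hc j l n B Q *
      compZ (i + k - 2 * m) (j + l - 2 * n)
        (Eb (i + k - 2 * m) (j + l - 2 * n) (A + P - m) (B + Q - n)) s t =
      (Hc i k m A P * hz (i + k - 2 * m) s (A + P - m)) *
        (Hc j l n B Q * hz (j + l - 2 * n) t (B + Q - n)) := by
    by_cases h1 : Hc i k m A P = 0
    · simp [h1]
    by_cases h2 : Hc j l n B Q = 0
    · simp [h2]
    have := Hc_ne hA hP h1
    have := Hc_ne hB hQ h2
    rw [compZ_Eb _ _ _ _ _ _ (by omega) (by omega)]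
    ring
  rw [hL, oneD _ _ _ _ _ _ hm hA hP hs, oneD _ _ _ _ _ _ hn hB hQ ht]
  simp only [compZ_Eb _ _ _ _ _ _ hA hB, compZ_Eb _ _ _ _ _ _ hP hQ]
  rw [Finset.sum_eq_single P, Finset.sum_eq_single Q]
  · push_cast; ring
  · intro q _ hq
    have : hz l q Q = 0 := by simp [hz, hq]
    simp [this]
  · intro h; simp at h; omega
  · intro p _ hp
    have : hz k p P = 0 := by simp [hz, hp]
    simp [this]
  · intro h; simp at h; omega
end
end
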